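/- Claim 1 (entropy identity without backward cross-link): Fix a blocklength-N code for the deterministic two-hop interference channel with parameters (n, m, f, n̄, m̄) with m̄ = 0, and let all signals be random variables determined by the pair of independent uniform messages (W1, W2). Then H(Y_{R1}[1], …, Y_{R1}[N] | W1) = H(X_{S2,1:m}[1], …, X_{S2,1:m}[N] | W1), and symmetrically H(Y_{R2}[1], …, Y_{R2}[N] | W2) = H(X_{S1,1:m}[1], …, X_{S1,1:m}[N] | W2), where X_{Si,1:m}[t] denotes the vector of the first m coordinates (top m levels) of X_{Si}[t], and H(·|·) denotes Shannon conditional entropy. -/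

import Mathlib

open scoped Classical

namespace TwoHopIC

/-- The `q × q` lower-shift matrix `S^k` over `F₂`, with `(S^k)_{i,j} = 1` iff `i = j + k`. -/
def shiftMat (q k : ℕ) : Matrix (Fin q) (Fin q) (ZMod 2) :=
  Matrix.of fun i j => if (i : ℕ) = (j : ℕ) + k then 1 else 0

/-- Forward (first-hop) signal alphabet: vectors in `F₂^q` with `q = max m n`. -/
abbrev FSig (n m : ℕ) := Fin (max m n) → ZMod 2

/-- Backward/second-hop signal alphabet: vectors in `F₂^q̄` with `q̄ = max(m̄, n̄, f)`. -/
abbrev BSig (f nb mb : ℕ) := Fin (max mb (max nb f)) → ZMod 2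

/-- A blocklength-`N` code with message sets of sizes `M1`, `M2`:
causal encoders at the sources (using the messages and the overheard signals),
causal encoders at the relays (using their received signals), and decoders at the
destinations (using the `N` received signals). -/
structure Code (n m f nb mb N M1 M2 : ℕ) where
  encS1 : (t : ℕ) → Fin M1 → (Fin t → BSig f nb mb) → FSig n m
  encS2 : (t : ℕ) → Fin M2 → (Fin t → BSig f nb mb) → FSig n m
  encR1 : (t : ℕ) → (Fin t → FSig n m) → BSig f nb mb
  encR2 : (t : ℕ) → (Fin t → FSig n m) → BSig f nb mb
  dec1 : (Fin N → BSig f nb mb) → Fin M1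
  dec2 : (Fin N → BSig f nb mb) → Fin M2

variable {n m f nb mb N M1 M2 : ℕ}

/-- Given a history `h` of source signals `(X_{S1}[·], X_{S2}[·])`, the signal received by
relay 1 at time `s`: `Y_{R1}[s] = S^{q-n} X_{S1}[s] ⊕ S^{q-m} X_{S2}[s]`. -/
def relayRx1 (n m : ℕ) {t : ℕ} (h : Fin t → FSig n m × FSig n m) (s : Fin t) : FSig n m :=
  (shiftMat (max m n) (max m n - n)).mulVec (h s).1 +
  (shiftMat (max m n) (max m n - m)).mulVec (h s).2

/-- `Y_{R2}[s] = S^{q-m} X_{S1}[s] ⊕ S^{q-n} X_{S2}[s]`. -/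
def relayRx2 (n m : ℕ) {t : ℕ} (h : Fin t → FSig n m × FSig n m) (s : Fin t) : FSig n m :=
  (shiftMat (max m n) (max m n - m)).mulVec (h s).1 +
  (shiftMat (max m n) (max m n - n)).mulVec (h s).2

/-- Relay 1 transmitted signal `X_{R1}[s]`, a causal function of `Y_{R1}[1..s-1]`. -/
def relayTx1 (C : Code n m f nb mb N M1 M2) {t : ℕ}
    (h : Fin t → FSig n m × FSig n m) (s : Fin t) : BSig f nb mb :=
  C.encR1 s.val (fun u => relayRx1 n m h ⟨u.val, lt_trans u.isLt s.isLt⟩)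

/-- Relay 2 transmitted signal `X_{R2}[s]`, a causal function of `Y_{R2}[1..s-1]`. -/
def relayTx2 (C : Code n m f nb mb N M1 M2) {t : ℕ}
    (h : Fin t → FSig n m × FSig n m) (s : Fin t) : BSig f nb mb :=
  C.encR2 s.val (fun u => relayRx2 n m h ⟨u.val, lt_trans u.isLt s.isLt⟩)

/-- Source 1 overheard signal `Y_{S1}[s] = S^{q̄-n̄} X_{R1}[s] ⊕ S^{q̄-m̄} X_{R2}[s]`. -/
def srcRx1 (C : Code n m f nb mb N M1 M2) {t : ℕ}
    (h : Fin t → FSig n m × FSig n m) (s : Fin t) : BSig f nb mb :=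
  (shiftMat (max mb (max nb f)) (max mb (max nb f) - nb)).mulVec (relayTx1 C h s) +
  (shiftMat (max mb (max nb f)) (max mb (max nb f) - mb)).mulVec (relayTx2 C h s)

/-- Source 2 overheard signal `Y_{S2}[s] = S^{q̄-n̄} X_{R2}[s] ⊕ S^{q̄-m̄} X_{R1}[s]`. -/
def srcRx2 (C : Code n m f nb mb N M1 M2) {t : ℕ}
    (h : Fin t → FSig n m × FSig n m) (s : Fin t) : BSig f nb mb :=
  (shiftMat (max mb (max nb f)) (max mb (max nb f) - nb)).mulVec (relayTx2 C h s) +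
  (shiftMat (max mb (max nb f)) (max mb (max nb f) - mb)).mulVec (relayTx1 C h s)

/-- The history `(X_{S1}[1..t], X_{S2}[1..t])` of source signals determined by the
messages `(w1, w2)`: at each time the sources apply their causal encoders to their
message and the overheard signals so far. -/
def srcHist (C : Code n m f nb mb N M1 M2) (w1 : Fin M1) (w2 : Fin M2) :
    (t : ℕ) → Fin t → FSig n m × FSig n m
  | 0 => fun i => i.elim0
  | t + 1 =>
    Fin.snoc (srcHist C w1 w2 t)
      (C.encS1 t w1 (srcRx1 C (srcHist C w1 w2 t)),
       C.encS2 t w2 (srcRx2 C (srcHist C w1 w2 t)))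

/-- `(X_{S1}[t], X_{S2}[t])`. -/
def srcXat (C : Code n m f nb mb N M1 M2) (w1 : Fin M1) (w2 : Fin M2) (t : ℕ) :
    FSig n m × FSig n m :=
  srcHist C w1 w2 (t + 1) (Fin.last t)

/-- `Y_{R1}[t]`. -/
def relayRxAt1 (C : Code n m f nb mb N M1 M2) (w1 : Fin M1) (w2 : Fin M2) (t : ℕ) :
    FSig n m :=
  relayRx1 n m (srcHist C w1 w2 (t + 1)) (Fin.last t)

/-- `Y_{R2}[t]`. -/
def relayRxAt2 (C : Code n m f nb mb N M1 M2) (w1 : Fin M1) (w2 : Fin M2) (t : ℕ) :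
    FSig n m :=
  relayRx2 n m (srcHist C w1 w2 (t + 1)) (Fin.last t)

/-- `X_{R1}[t]`. -/
def relayTxAt1 (C : Code n m f nb mb N M1 M2) (w1 : Fin M1) (w2 : Fin M2) (t : ℕ) :
    BSig f nb mb :=
  relayTx1 C (srcHist C w1 w2 (t + 1)) (Fin.last t)

/-- `X_{R2}[t]`. -/
def relayTxAt2 (C : Code n m f nb mb N M1 M2) (w1 : Fin M1) (w2 : Fin M2) (t : ℕ) :
    BSig f nb mb :=
  relayTx2 C (srcHist C w1 w2 (t + 1)) (Fin.last t)

/-- `Y_{D1}[t] = S^{q̄-f} X_{R1}[t]`. -/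
def destRx1 (C : Code n m f nb mb N M1 M2) (w1 : Fin M1) (w2 : Fin M2) (t : ℕ) :
    BSig f nb mb :=
  (shiftMat (max mb (max nb f)) (max mb (max nb f) - f)).mulVec (relayTxAt1 C w1 w2 t)

/-- `Y_{D2}[t] = S^{q̄-f} X_{R2}[t]`. -/
def destRx2 (C : Code n m f nb mb N M1 M2) (w1 : Fin M1) (w2 : Fin M2) (t : ℕ) :
    BSig f nb mb :=
  (shiftMat (max mb (max nb f)) (max mb (max nb f) - f)).mulVec (relayTxAt2 C w1 w2 t)

/-- Probability of decoding error under independent uniform messages: since the channel is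
deterministic, this is the fraction of message pairs `(w1, w2)` on which some decoder errs. -/
noncomputable def errProb (C : Code n m f nb mb N M1 M2) : ℝ :=
  ((Finset.univ.filter fun w : Fin M1 × Fin M2 =>
      C.dec1 (fun t => destRx1 C w.1 w.2 t.val) ≠ w.1 ∨
      C.dec2 (fun t => destRx2 C w.1 w.2 t.val) ≠ w.2).card : ℝ) / ((M1 : ℝ) * (M2 : ℝ))

/-- A nonnegative rate pair `(R1, R2)` is achievable if for every `ε > 0` there is a
blocklength `N ≥ 1` and a code with message sets of sizes `⌈2^(N R1)⌉`, `⌈2^(N R2)⌉`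
whose probability of error is at most `ε`. -/
def Achievable (n m f nb mb : ℕ) (R1 R2 : ℝ) : Prop :=
  0 ≤ R1 ∧ 0 ≤ R2 ∧
    ∀ ε : ℝ, 0 < ε →
      ∃ N : ℕ, 0 < N ∧
        ∃ C : Code n m f nb mb N ⌈(2 : ℝ) ^ ((N : ℝ) * R1)⌉₊ ⌈(2 : ℝ) ^ ((N : ℝ) * R2)⌉₊,
          errProb C ≤ ε

/-- The sum capacity `C_sum = sup { R1 + R2 : (R1, R2) achievable }`. -/
noncomputable def sumCapacity (n m f nb mb : ℕ) : ℝ :=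
  sSup {r : ℝ | ∃ R1 R2 : ℝ, Achievable n m f nb mb R1 R2 ∧ r = R1 + R2}

end TwoHopIC

namespace TwoHopIC

/-- Probability mass function of a random variable `X` on a finite uniform sample space. -/
noncomputable def pmf {Ω α : Type*} [Fintype Ω] (X : Ω → α) (a : α) : ℝ :=
  ((Finset.univ.filter fun ω => X ω = a).card : ℝ) / (Fintype.card Ω : ℝ)

/-- Shannon entropy (base 2) of a random variable on a finite uniform sample space. -/
noncomputable def entropy {Ω α : Type*} [Fintype Ω] [Fintype α] (X : Ω → α) : ℝ :=
  -∑ a : α, pmf X a * Real.logb 2 (pmf X a)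

/-- Conditional (Shannon) entropy `H(X | Y) = H(X, Y) - H(Y)`. -/
noncomputable def condEntropy {Ω α β : Type*} [Fintype Ω] [Fintype α] [Fintype β]
    (X : Ω → α) (Y : Ω → β) : ℝ :=
  entropy (fun ω => (X ω, Y ω)) - entropy Y

end TwoHopIC

namespace TwoHopIC

lemma sum_pmf_mul {Ω α : Type*} [Fintype Ω] [Fintype α] (X : Ω → α) (g : α → ℝ) :
    ∑ a : α, pmf X a * g a = (∑ ω : Ω, g (X ω)) / Fintype.card Ω := by
  rw [← Finset.sum_fiberwise Finset.univ X (fun ω => g (X ω)), Finset.sum_div]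
  refine Finset.sum_congr rfl fun a _ => ?_
  have h : ∑ ω ∈ Finset.univ.filter (fun ω => X ω = a), g (X ω) =
      ∑ ω ∈ Finset.univ.filter (fun ω => X ω = a), g a :=
    Finset.sum_congr rfl fun ω hω => by rw [(Finset.mem_filter.mp hω).2]
  rw [h, Finset.sum_const, nsmul_eq_mul, pmf]
  ring

/-- Entropy depends only on the partition of the sample space induced by the random variable. -/
lemma entropy_congr {Ω α β : Type*} [Fintype Ω] [Fintype α] [Fintype β]
    {X : Ω → α} {Y : Ω → β} (h : ∀ ω ω', X ω = X ω' ↔ Y ω = Y ω') :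
    entropy X = entropy Y := by
  have hp : ∀ ω, pmf X (X ω) = pmf Y (Y ω) := fun ω => by simp only [pmf, h]
  simp only [entropy, sum_pmf_mul X (fun a => Real.logb 2 (pmf X a)),
    sum_pmf_mul Y (fun a => Real.logb 2 (pmf Y a)), hp]

lemma condEntropy_congr {Ω α β γ : Type*} [Fintype Ω] [Fintype α] [Fintype β] [Fintype γ]
    {X : Ω → α} {Y : Ω → β} {W : Ω → γ}
    (h : ∀ ω ω', W ω = W ω' → (X ω = X ω' ↔ Y ω = Y ω')) :
    condEntropy X W = condEntropy Y W := by
  unfold condEntropy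
  rw [entropy_congr (X := fun ω => (X ω, W ω)) (Y := fun ω => (Y ω, W ω))]
  intro ω ω'
  simp only [Prod.mk.injEq]
  exact and_congr_left (h ω ω')

lemma shiftMat_mulVec_apply (q k : ℕ) (x : Fin q → ZMod 2) (i j : Fin q)
    (hij : (i : ℕ) = j + k) : (shiftMat q k).mulVec x i = x j := by
  simp only [Matrix.mulVec, dotProduct, shiftMat, Matrix.of_apply]
  rw [Finset.sum_eq_single j]
  · simp [hij]
  · intro l _ hl
    rw [if_neg, zero_mul]
    intro h
    exact hl (Fin.ext (by omega))
  · simp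

lemma shiftMat_mulVec_apply_of_lt (q k : ℕ) (x : Fin q → ZMod 2) (i : Fin q)
    (hi : (i : ℕ) < k) : (shiftMat q k).mulVec x i = 0 := by
  simp only [Matrix.mulVec, dotProduct, shiftMat, Matrix.of_apply]
  refine Finset.sum_eq_zero fun l _ => ?_
  rw [if_neg (by omega), zero_mul]

/-- A shift by `q` annihilates every vector. -/
lemma shiftMat_self_mulVec (q : ℕ) (x : Fin q → ZMod 2) : (shiftMat q q).mulVec x = 0 :=
  funext fun i => shiftMat_mulVec_apply_of_lt q q x i i.isLt

/-- The shift by `q - m` retains exactly the top `m` levels. -/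
lemma shiftMat_mulVec_eq_iff {q m : ℕ} (hm : m ≤ q) (x y : Fin q → ZMod 2) :
    (shiftMat q (q - m)).mulVec x = (shiftMat q (q - m)).mulVec y ↔
      ∀ i : Fin m, x (Fin.castLE hm i) = y (Fin.castLE hm i) := by
  constructor
  · intro h i
    have hi := congrFun h ⟨i + (q - m), by omega⟩
    rwa [shiftMat_mulVec_apply q _ x _ (Fin.castLE hm i) rfl,
      shiftMat_mulVec_apply q _ y _ (Fin.castLE hm i) rfl] at hi
  · intro h
    funext i
    by_cases hi : (i : ℕ) < q - m
    · rw [shiftMat_mulVec_apply_of_lt q _ x i hi, shiftMat_mulVec_apply_of_lt q _ y i hi]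
    · have hij : (i : ℕ) = (Fin.castLE hm ⟨i - (q - m), by omega⟩ : Fin q) + (q - m) := by
        simp only [Fin.val_castLE]
        omega
      rw [shiftMat_mulVec_apply q _ x i _ hij, shiftMat_mulVec_apply q _ y i _ hij]
      exact h _

variable {n m f nb mb N M1 M2 : ℕ}

lemma srcHist_apply (C : Code n m f nb mb N M1 M2) (w1 : Fin M1) (w2 : Fin M2) (t : ℕ)
    (s : Fin t) : srcHist C w1 w2 t s = srcXat C w1 w2 s := by
  induction t with
  | zero => exact s.elim0
  | succ t ih =>
    refine Fin.lastCases rfl (fun s => ?_) s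
    rw [srcHist, Fin.snoc_castSucc, ih, Fin.val_castSucc]

lemma srcXat_eq (C : Code n m f nb mb N M1 M2) (w1 : Fin M1) (w2 : Fin M2) (t : ℕ) :
    srcXat C w1 w2 t =
      (C.encS1 t w1 (srcRx1 C (srcHist C w1 w2 t)),
       C.encS2 t w2 (srcRx2 C (srcHist C w1 w2 t))) := by
  rw [srcXat, srcHist, Fin.snoc_last]

lemma relayRx1_srcHist (C : Code n m f nb mb N M1 M2) (w1 : Fin M1) (w2 : Fin M2) (t : ℕ)
    (s : Fin t) : relayRx1 n m (srcHist C w1 w2 t) s = relayRxAt1 C w1 w2 s := by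
  simp only [relayRxAt1, relayRx1, srcHist_apply, Fin.val_last]

lemma relayRx2_srcHist (C : Code n m f nb mb N M1 M2) (w1 : Fin M1) (w2 : Fin M2) (t : ℕ)
    (s : Fin t) : relayRx2 n m (srcHist C w1 w2 t) s = relayRxAt2 C w1 w2 s := by
  simp only [relayRxAt2, relayRx2, srcHist_apply, Fin.val_last]

/-- Without backward cross-link, `X_{S1}[t]` is determined by `W1` and `Y_{R1}[1..t-1]`. -/
lemma srcXat_fst_congr (C : Code n m f nb 0 N M1 M2) (w1 : Fin M1) {w2 w2' : Fin M2} {t : ℕ}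
    (h : ∀ s < t, relayRxAt1 C w1 w2 s = relayRxAt1 C w1 w2' s) :
    (srcXat C w1 w2 t).1 = (srcXat C w1 w2' t).1 := by
  rw [srcXat_eq, srcXat_eq]
  dsimp only
  congr 1
  funext s
  simp only [srcRx1, Nat.sub_zero, shiftMat_self_mulVec, relayTx1, relayRx1_srcHist]
  congr 3
  funext u
  exact h u (u.isLt.trans s.isLt)

/-- Without backward cross-link, `X_{S2}[t]` is determined by `W2` and `Y_{R2}[1..t-1]`. -/
lemma srcXat_snd_congr (C : Code n m f nb 0 N M1 M2) {w1 w1' : Fin M1} (w2 : Fin M2) {t : ℕ}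
    (h : ∀ s < t, relayRxAt2 C w1 w2 s = relayRxAt2 C w1' w2 s) :
    (srcXat C w1 w2 t).2 = (srcXat C w1' w2 t).2 := by
  rw [srcXat_eq, srcXat_eq]
  dsimp only
  congr 1
  funext s
  simp only [srcRx2, Nat.sub_zero, shiftMat_self_mulVec, relayTx2, relayRx2_srcHist]
  congr 3
  funext u
  exact h u (u.isLt.trans s.isLt)

/-- If agreement of `y` and `y'` before time `t` makes agreement at time `t` equivalent to `P t`,
then agreement over a block is equivalent to `P` over the block. -/
lemma agree_iff_of_causal {V : Type*} {y y' : ℕ → V} {P : ℕ → Prop}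
    (step : ∀ t, (∀ s < t, y s = y' s) → (y t = y' t ↔ P t)) (N : ℕ) :
    (∀ t < N, y t = y' t) ↔ ∀ t < N, P t := by
  constructor
  · intro h t ht
    exact (step t fun s hs => h s (hs.trans ht)).mp (h t ht)
  · intro h t
    induction t using Nat.strong_induction_on with
    | _ t ih =>
      intro ht
      exact (step t fun s hs => ih s hs (hs.trans ht)).mpr (h t ht)

lemma relayRxAt1_agree_iff (C : Code n m f nb 0 N M1 M2) (w1 : Fin M1) (w2 w2' : Fin M2) :
    (∀ t < N, relayRxAt1 C w1 w2 t = relayRxAt1 C w1 w2' t) ↔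
      ∀ t < N, ∀ i : Fin m, (srcXat C w1 w2 t).2 (Fin.castLE (le_max_left m n) i) =
        (srcXat C w1 w2' t).2 (Fin.castLE (le_max_left m n) i) := by
  refine agree_iff_of_causal (fun t h => ?_) N
  rw [← shiftMat_mulVec_eq_iff]
  simp only [relayRxAt1, relayRx1, srcHist_apply, Fin.val_last, srcXat_fst_congr C w1 h,
    add_right_inj]

lemma relayRxAt2_agree_iff (C : Code n m f nb 0 N M1 M2) (w1 w1' : Fin M1) (w2 : Fin M2) :
    (∀ t < N, relayRxAt2 C w1 w2 t = relayRxAt2 C w1' w2 t) ↔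
      ∀ t < N, ∀ i : Fin m, (srcXat C w1 w2 t).1 (Fin.castLE (le_max_left m n) i) =
        (srcXat C w1' w2 t).1 (Fin.castLE (le_max_left m n) i) := by
  refine agree_iff_of_causal (fun t h => ?_) N
  rw [← shiftMat_mulVec_eq_iff]
  simp only [relayRxAt2, relayRx2, srcHist_apply, Fin.val_last, srcXat_snd_congr C w2 h,
    add_left_inj]

end TwoHopIC

open TwoHopIC in
/-- Claim 1: entropy identity without backward cross-link (`m̄ = 0`):
`H(Y_{R1}^N | W1) = H(X_{S2,1:m}^N | W1)` and symmetrically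
`H(Y_{R2}^N | W2) = H(X_{S1,1:m}^N | W2)`. -/
theorem claim1_entropy_identity (n m f nb N M1 M2 : ℕ)
    (C : Code n m f nb 0 N M1 M2) :
    condEntropy
        (fun w : Fin M1 × Fin M2 => fun t : Fin N => relayRxAt1 C w.1 w.2 t.val)
        (fun w : Fin M1 × Fin M2 => w.1) =
      condEntropy
        (fun w : Fin M1 × Fin M2 => fun t : Fin N => fun i : Fin m =>
          (srcXat C w.1 w.2 t.val).2 (Fin.castLE (le_max_left m n) i))
        (fun w : Fin M1 × Fin M2 => w.1) ∧
    condEntropy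
        (fun w : Fin M1 × Fin M2 => fun t : Fin N => relayRxAt2 C w.1 w.2 t.val)
        (fun w : Fin M1 × Fin M2 => w.2) =
      condEntropy
        (fun w : Fin M1 × Fin M2 => fun t : Fin N => fun i : Fin m =>
          (srcXat C w.1 w.2 t.val).1 (Fin.castLE (le_max_left m n) i))
        (fun w : Fin M1 × Fin M2 => w.2) := by
  constructor
  · refine condEntropy_congr ?_
    rintro ⟨w1, w2⟩ ⟨w1', w2'⟩ (rfl : w1 = w1')
    simpa only [funext_iff, Fin.forall_iff] using relayRxAt1_agree_iff C w1 w2 w2'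
  · refine condEntropy_congr ?_
    rintro ⟨w1, w2⟩ ⟨w1', w2'⟩ (rfl : w2 = w2')
    simpa only [funext_iff, Fin.forall_iff] using relayRxAt2_agree_iff C w1 w1' w2
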